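/- Second Stokeslet difference term at the fiber surface: there exist constants C > 0 and ε₀ > 0, depending only on c_Γ and κ_max, such that for all 0 < ε < ε₀, 0 < δ < ε₀, every f ∈ C¹(ℝ/ℤ; ℝ³), every s ∈ ℝ/ℤ and θ ∈ [0,2π), the quantity S₂ = ∫_{−1/2}^{1/2} ( 1/(|R|² + δ²)^{3/2} − 1/|R|³ ) (R Rᵀ) f(s − s̄) ds̄ (with R = R(s,s̄,θ)) satisfies |S₂ + log(1 + δ²/ε²) e_s(s)(e_s(s)·f(s)) + (2δ²/(ε² + δ²)) e_ρ(s,θ)(e_ρ(s,θ)·f(s))| ≤ C (ε² + δ²)^{1/2} |log(ε² + δ²)| ‖f‖_{C¹}. -/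

import Mathlib

open MeasureTheory

noncomputable section

local notation "⟪" x ", " y "⟫" => @inner ℝ _ _ x y

abbrev V3 : Type := EuclideanSpace ℝ (Fin 3)

/-- The `C⁰` (sup) norm of a function `ℝ/ℤ → ℝ³`. -/
def C0norm (f : ℝ → V3) : ℝ := ⨆ s : ℝ, ‖f s‖

/-- The `C¹` norm of a function `ℝ/ℤ → ℝ³`. -/
def C1norm (f : ℝ → V3) : ℝ := C0norm f + C0norm (deriv f)

/-- The radial unit vector `e_ρ(s,θ) = cos θ e_{n1}(s) + sin θ e_{n2}(s)`. -/
def ePerp (en1 en2 : ℝ → V3) (s θ : ℝ) : V3 :=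
  Real.cos θ • en1 s + Real.sin θ • en2 s

/-- `R(s, s̄, θ) = X(s) + ε e_ρ(s,θ) − X(s − s̄)`. -/
def Rvec (X en1 en2 : ℝ → V3) (ε s sb θ : ℝ) : V3 :=
  X s + ε • ePerp en1 en2 s θ - X (s - sb)

/-- The slender-body geometry hypotheses: `X : ℝ/ℤ → ℝ³` is a `C²` closed curve
parameterized by arclength, non-self-intersecting with constant `cΓ`, with curvature
bounded by `κmax`, together with a `C¹` orthonormal frame `(X', en1, en2)`. -/
structure SlenderGeom (cΓ κmax : ℝ) (X en1 en2 : ℝ → V3) : Prop where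
  smooth : ContDiff ℝ 2 X
  periodicX : ∀ s, X (s + 1) = X s
  arclength : ∀ s, ‖deriv X s‖ = 1
  no_self_intersect : ∀ s t : ℝ, |s - t| ≤ 1 / 2 → cΓ * |s - t| ≤ ‖X s - X t‖
  curvature_max : ∀ s, ‖deriv (deriv X) s‖ ≤ κmax
  en1_smooth : ContDiff ℝ 1 en1
  en2_smooth : ContDiff ℝ 1 en2
  en1_periodic : ∀ s, en1 (s + 1) = en1 s
  en2_periodic : ∀ s, en2 (s + 1) = en2 s
  en1_unit : ∀ s, ‖en1 s‖ = 1
  en2_unit : ∀ s, ‖en2 s‖ = 1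
  es_en1 : ∀ s, ⟪deriv X s, en1 s⟫ = 0
  es_en2 : ∀ s, ⟪deriv X s, en2 s⟫ = 0
  en1_en2 : ∀ s, ⟪en1 s, en2 s⟫ = 0

/-- The singular Stokeslet `S(y) v = v/|y| + (y·v) y/|y|³`. -/
def stokeslet (y v : V3) : V3 := ‖y‖⁻¹ • v + (‖y‖ ^ 3)⁻¹ • ⟪y, v⟫ • y

/-- The singular doublet `D(y) v = v/|y|³ − 3 (y·v) y/|y|⁵`. -/
def doubletK (y v : V3) : V3 := (‖y‖ ^ 3)⁻¹ • v - (3 * (‖y‖ ^ 5)⁻¹) • ⟪y, v⟫ • y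

/-- The regularized Stokeslet `S_δ(y) v`. -/
def stokesletReg (δ : ℝ) (y v : V3) : V3 :=
  ((‖y‖ ^ 2 + δ ^ 2) ^ ((1 : ℝ) / 2))⁻¹ • v
    + ((‖y‖ ^ 2 + δ ^ 2) ^ ((3 : ℝ) / 2))⁻¹ • (⟪y, v⟫ • y + δ ^ 2 • v)

/-- The regularized doublet `D_δ(y) v`. -/
def doubletReg (δ : ℝ) (y v : V3) : V3 :=
  ((‖y‖ ^ 2 + δ ^ 2) ^ ((3 : ℝ) / 2))⁻¹ • v
    - (3 * ((‖y‖ ^ 2 + δ ^ 2) ^ ((5 : ℝ) / 2))⁻¹) • (⟪y, v⟫ • y + δ ^ 2 • v)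

/-- The classical slender-body velocity `u^SB(x)` with doublet coefficient `ε²/2`. -/
def uSB (X f : ℝ → V3) (ε : ℝ) (x : V3) : V3 :=
  (8 * Real.pi)⁻¹ • ∫ t in (0:ℝ)..1,
    (stokeslet (x - X t) (f t) + (ε ^ 2 / 2) • doubletK (x - X t) (f t))

/-- The regularized slender-body velocity with doublet coefficient `β`. -/
def uReg (X f : ℝ → V3) (β δ : ℝ) (x : V3) : V3 :=
  (8 * Real.pi)⁻¹ • ∫ t in (0:ℝ)..1,
    (stokesletReg δ (x - X t) (f t) + β • doubletReg δ (x - X t) (f t))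

/-- The Keller–Rubinow classical centerline velocity `u^SB_C(X(s))`. -/
def uSBC (X f : ℝ → V3) (ε s : ℝ) : V3 :=
  (8 * Real.pi)⁻¹ •
    ((f s - (3 : ℝ) • ⟪deriv X s, f s⟫ • deriv X s
        - (2 * Real.log (Real.pi * ε / 4)) • (f s + ⟪deriv X s, f s⟫ • deriv X s))
      + ∫ t in (0:ℝ)..1,
          ((‖X s - X t‖⁻¹ • f t
              + (‖X s - X t‖ ^ 3)⁻¹ • ⟪X s - X t, f t⟫ • (X s - X t))
            - |Real.sin (Real.pi * (s - t)) / Real.pi|⁻¹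
                • (f s + ⟪deriv X s, f s⟫ • deriv X s)))

/-- The regularized pressure `p^δ(x)`. -/
def pReg (X f : ℝ → V3) (δ : ℝ) (x : V3) : ℝ :=
  (4 * Real.pi)⁻¹ * ∫ t in (0:ℝ)..1,
    (⟪x - X t, f t⟫ * ((‖x - X t‖ ^ 2 + δ ^ 2) ^ ((3 : ℝ) / 2))⁻¹
      + 3 * δ ^ 2 * ⟪x - X t, f t⟫ * (2 * (‖x - X t‖ ^ 2 + δ ^ 2) ^ ((5 : ℝ) / 2))⁻¹)

/-- The symmetric strain tensor `E(u) = (∇u + (∇u)ᵀ)/2` applied to the vector `n`. -/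
def strainApply (u : V3 → V3) (x n : V3) : V3 :=
  (2 : ℝ)⁻¹ • (fderiv ℝ u x n + gradient (fun y => ⟪u y, n⟫) x)

/-- The surface Jacobian `J_ε(s,θ) = ε(1 − ε(κ₁ cos θ + κ₂ sin θ))`. -/
def Jfac (X en1 en2 : ℝ → V3) (ε s θ : ℝ) : ℝ :=
  ε * (1 - ε * (⟪deriv (deriv X) s, en1 s⟫ * Real.cos θ
      + ⟪deriv (deriv X) s, en2 s⟫ * Real.sin θ))

/-- The regularized surface force density
`f^δ(s) = ∫_0^{2π} (2 E(u^δ) n − p^δ n) J_ε dθ`, with `n = −e_ρ`. -/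
def fReg (X en1 en2 f : ℝ → V3) (ε δ s : ℝ) : V3 :=
  ∫ θ in (0:ℝ)..(2 * Real.pi),
    Jfac X en1 en2 ε s θ •
      ((2 : ℝ) • strainApply (uReg X f ((ε ^ 2 + δ ^ 2) / 2) δ)
          (X s + ε • ePerp en1 en2 s θ) (-ePerp en1 en2 s θ)
        - pReg X f δ (X s + ε • ePerp en1 en2 s θ) • (-ePerp en1 en2 s θ))

/-- The vector field `d_n^δ[f](x)`. -/
def dReg (X f : ℝ → V3) (δ : ℝ) (n : ℕ) (x : V3) : V3 :=
  (8 * Real.pi)⁻¹ • ∫ t in (0:ℝ)..1,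
    (δ ^ 2 * ((‖x - X t‖ ^ 2 + δ ^ 2) ^ ((n : ℝ) / 2))⁻¹) • f t

/-- The scalar field `d_5^δ[f·R](x)`. -/
def dRegP (X f : ℝ → V3) (δ : ℝ) (x : V3) : ℝ :=
  (8 * Real.pi)⁻¹ * ∫ t in (0:ℝ)..1,
    δ ^ 2 * ⟪x - X t, f t⟫ * ((‖x - X t‖ ^ 2 + δ ^ 2) ^ ((5 : ℝ) / 2))⁻¹

/-- The extra force contribution
`F^δ(s) = ∫_0^{2π} (2E(d₃^δ[f])n − 3(ε²+δ²)E(d₅^δ[f])n − 3 d₅^δ[f·R] n) J_ε dθ`. -/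
def Fextra (X en1 en2 f : ℝ → V3) (ε δ s : ℝ) : V3 :=
  ∫ θ in (0:ℝ)..(2 * Real.pi),
    Jfac X en1 en2 ε s θ •
      ((2 : ℝ) • strainApply (dReg X f δ 3) (X s + ε • ePerp en1 en2 s θ)
          (-ePerp en1 en2 s θ)
        - (3 * (ε ^ 2 + δ ^ 2)) • strainApply (dReg X f δ 5)
            (X s + ε • ePerp en1 en2 s θ) (-ePerp en1 en2 s θ)
        - (3 * dRegP X f δ (X s + ε • ePerp en1 en2 s θ)) • (-ePerp en1 en2 s θ))

/-- The radial profile `(ρ² + δ²)^(-3/2) - ρ⁻³` of the second Stokeslet difference. -/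
def kerDiff (δ ρ : ℝ) : ℝ := (√(ρ ^ 2 + δ ^ 2) ^ 3)⁻¹ - (ρ ^ 3)⁻¹

theorem rpow_three_halves {x : ℝ} (hx : 0 ≤ x) : x ^ ((3 : ℝ) / 2) = √x ^ 3 := by
  rw [Real.sqrt_eq_rpow, ← Real.rpow_natCast, ← Real.rpow_mul hx]
  norm_num

theorem abs_kerDiff_le {δ m ρ : ℝ} (hm : 0 < m) (hρ : m ≤ ρ) :
    |kerDiff δ ρ| ≤ 3 * δ ^ 2 / (m ^ 3 * (m ^ 2 + δ ^ 2)) := by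
  have hρ0 : 0 < ρ := hm.trans_le hρ
  have hmono : 3 * δ ^ 2 / (ρ ^ 3 * (ρ ^ 2 + δ ^ 2)) ≤ 3 * δ ^ 2 / (m ^ 3 * (m ^ 2 + δ ^ 2)) := by
    gcongr
  refine le_trans ?_ hmono
  unfold kerDiff
  set A := √(ρ ^ 2 + δ ^ 2)
  have hA2 : A ^ 2 = ρ ^ 2 + δ ^ 2 := Real.sq_sqrt (by positivity)
  have hA0 : 0 < A := Real.sqrt_pos.2 (by positivity)
  have hle : ρ ≤ A := Real.le_sqrt_of_sq_le (by nlinarith [sq_nonneg δ])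
  rw [← hA2, abs_sub_comm, abs_of_nonneg (sub_nonneg.2 (by gcongr)),
    show 3 * δ ^ 2 / (ρ ^ 3 * A ^ 2) = 3 * δ ^ 2 * A / (ρ ^ 3 * A ^ 3) by field_simp,
    show (ρ ^ 3)⁻¹ - (A ^ 3)⁻¹ = (A ^ 3 - ρ ^ 3) / (ρ ^ 3 * A ^ 3) by field_simp]
  gcongr
  have hδ : δ ^ 2 = (A - ρ) * (A + ρ) := by linarith
  have h : 0 ≤ A - ρ := sub_nonneg.2 hle
  rw [hδ]
  have : 3 * ((A - ρ) * (A + ρ)) * A - (A ^ 3 - ρ ^ 3)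
    = (A - ρ) * (2 * A ^ 2 + 2 * A * ρ - ρ ^ 2) := by ring
  have : 0 ≤ (A - ρ) * (2 * A ^ 2 + 2 * A * ρ - ρ ^ 2) := mul_nonneg h (by nlinarith)
  linarith

theorem hasDerivAt_inv_sqrt_pow_three {b s : ℝ} (h : 0 < s ^ 2 + b) :
    HasDerivAt (fun x : ℝ => (√(x ^ 2 + b) ^ 3)⁻¹) (-(3 * s * (√(s ^ 2 + b) ^ 5)⁻¹)) s := by
  have h1 : HasDerivAt (fun x : ℝ => x ^ 2 + b) (2 * s) s := by
    simpa using (hasDerivAt_pow 2 s).add_const b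
  have hA : 0 < √(s ^ 2 + b) := Real.sqrt_pos.2 h
  refine (((h1.sqrt h.ne').pow 3).inv (pow_pos hA 3).ne').congr_deriv ?_
  norm_num
  field_simp

theorem hasDerivAt_kerDiff {δ ρ : ℝ} (hρ : 0 < ρ) :
    HasDerivAt (kerDiff δ) (3 * (ρ ^ 4)⁻¹ - 3 * ρ * (√(ρ ^ 2 + δ ^ 2) ^ 5)⁻¹) ρ := by
  have h := (hasDerivAt_inv_sqrt_pow_three (b := δ ^ 2) (s := ρ) (by positivity)).sub
    ((hasDerivAt_pow 3 ρ).inv (by positivity))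
  refine h.congr_deriv ?_
  norm_num
  field_simp
  ring

theorem abs_deriv_kerDiff_le {δ m ρ : ℝ} (hm : 0 < m) (hρ : m ≤ ρ) :
    |deriv (kerDiff δ) ρ| ≤ 15 * δ ^ 2 / (m ^ 4 * (m ^ 2 + δ ^ 2)) := by
  have hρ0 : 0 < ρ := hm.trans_le hρ
  have hmono : 15 * δ ^ 2 / (ρ ^ 4 * (ρ ^ 2 + δ ^ 2)) ≤
      15 * δ ^ 2 / (m ^ 4 * (m ^ 2 + δ ^ 2)) := by gcongr
  refine le_trans ?_ hmono
  rw [(hasDerivAt_kerDiff hρ0).deriv]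
  set A := √(ρ ^ 2 + δ ^ 2)
  have hA2 : A ^ 2 = ρ ^ 2 + δ ^ 2 := Real.sq_sqrt (by positivity)
  have hA0 : 0 < A := Real.sqrt_pos.2 (by positivity)
  have hle : ρ ≤ A := Real.le_sqrt_of_sq_le (by nlinarith [sq_nonneg δ])
  have h5 : ρ ^ 5 ≤ A ^ 5 := by gcongr
  rw [← hA2, show 3 * (ρ ^ 4)⁻¹ - 3 * ρ * (A ^ 5)⁻¹ = 3 * (A ^ 5 - ρ ^ 5) / (ρ ^ 4 * A ^ 5) by
      field_simp,
    abs_of_nonneg (div_nonneg (by linarith) (by positivity)),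
    show 15 * δ ^ 2 / (ρ ^ 4 * A ^ 2) = 15 * δ ^ 2 * A ^ 3 / (ρ ^ 4 * A ^ 5) by field_simp]
  refine div_le_div_of_nonneg_right ?_ (by positivity)
  have hδ : δ ^ 2 = (A - ρ) * (A + ρ) := by linarith
  have h : 0 ≤ A - ρ := sub_nonneg.2 hle
  have h2 : ρ ^ 2 ≤ A ^ 2 := by gcongr
  have h3 : ρ ^ 3 ≤ A ^ 3 := by gcongr
  have h4 : ρ ^ 4 ≤ A ^ 4 := by gcongr
  have e1 : A ^ 3 * ρ ≤ A ^ 4 := by nlinarith [pow_pos hA0 3]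
  have e2 : A ^ 2 * ρ ^ 2 ≤ A ^ 4 := by nlinarith [pow_pos hA0 2]
  have e3 : A * ρ ^ 3 ≤ A ^ 4 := by nlinarith
  have e4 : 0 ≤ A ^ 3 * ρ := by positivity
  rw [hδ]
  have : 15 * ((A - ρ) * (A + ρ)) * A ^ 3 - 3 * (A ^ 5 - ρ ^ 5) =
    (A - ρ) * (15 * (A ^ 4 + A ^ 3 * ρ) -
      3 * (A ^ 4 + A ^ 3 * ρ + A ^ 2 * ρ ^ 2 + A * ρ ^ 3 + ρ ^ 4)) := by ring
  have : 0 ≤ (A - ρ) * (15 * (A ^ 4 + A ^ 3 * ρ) -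
      3 * (A ^ 4 + A ^ 3 * ρ + A ^ 2 * ρ ^ 2 + A * ρ ^ 3 + ρ ^ 4)) :=
    mul_nonneg h (by linarith)
  linarith

theorem abs_kerDiff_sub_le {δ m ρ σ : ℝ} (hm : 0 < m) (hρ : m ≤ ρ) (hσ : m ≤ σ) :
    |kerDiff δ ρ - kerDiff δ σ| ≤ 15 * δ ^ 2 / (m ^ 4 * (m ^ 2 + δ ^ 2)) * |ρ - σ| :=
  Convex.norm_image_sub_le_of_norm_deriv_le (𝕜 := ℝ) (s := Set.Ici m)
    (fun _ hx => (hasDerivAt_kerDiff (hm.trans_le hx)).differentiableAt)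
    (fun _ hx => abs_deriv_kerDiff_le hm hx) (convex_Ici m) hσ hρ

theorem norm_kerDiff_smul_sub_le {E : Type*} [NormedAddCommGroup E] [InnerProductSpace ℝ E]
    {c K M δ r t F : ℝ} {R R₀ v w : E} (hc : 0 < c) (hc1 : c ≤ 1) (hK : 0 ≤ K)
    (hr : 0 < r) (htr : |t| ≤ r) (hR₀ : ‖R₀‖ = r) (hcR : c * r ≤ ‖R‖) (hRM : ‖R‖ ≤ M * r)
    (hRR : ‖R - R₀‖ ≤ K * t ^ 2) (hv : ‖v‖ ≤ F) (hwv : ‖w - v‖ ≤ F * |t|) :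
    ‖(kerDiff δ ‖R‖ * ⟪R, w⟫) • R - (kerDiff δ r * ⟪R₀, v⟫) • R₀‖ ≤
      (3 * M ^ 2 + 15 * K * M ^ 2 + 3 * K * (M + 1)) / c ^ 6 * F * (δ ^ 2 / (t ^ 2 + δ ^ 2)) := by
  have hF : 0 ≤ F := (norm_nonneg v).trans hv
  have hM : 0 ≤ M := nonneg_of_mul_nonneg_left ((norm_nonneg R).trans hRM) hr
  have hcr : 0 < c * r := by positivity
  have hcr' : c * r ≤ r := by nlinarith
  have ht2 : t ^ 2 ≤ r ^ 2 := sq_le_sq.2 (by rwa [abs_of_pos hr])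
  set D := δ ^ 2 / (r ^ 2 + δ ^ 2) with hD
  have hD0 : 0 ≤ D := by positivity
  have hden : c ^ 2 * (r ^ 2 + δ ^ 2) ≤ (c * r) ^ 2 + δ ^ 2 := by
    nlinarith [mul_le_of_le_one_left (sq_nonneg δ) (pow_le_one₀ hc.le hc1 (n := 2))]
  have hk3 : 3 * δ ^ 2 / ((c * r) ^ 3 * ((c * r) ^ 2 + δ ^ 2)) ≤ 3 / c ^ 6 * D / r ^ 3 := by
    calc _ ≤ 3 * δ ^ 2 / ((c * r) ^ 3 * (c ^ 2 * (r ^ 2 + δ ^ 2))) := by gcongr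
      _ = 3 / c ^ 5 * D / r ^ 3 := by rw [hD]; field_simp
      _ ≤ _ := by
        gcongr 3 / ?_ * D / r ^ 3
        exact pow_le_pow_of_le_one hc.le hc1 (by norm_num)
  have hk4 : 15 * δ ^ 2 / ((c * r) ^ 4 * ((c * r) ^ 2 + δ ^ 2)) ≤ 15 / c ^ 6 * D / r ^ 4 := by
    calc _ ≤ 15 * δ ^ 2 / ((c * r) ^ 4 * (c ^ 2 * (r ^ 2 + δ ^ 2))) := by gcongr
      _ = _ := by rw [hD]; field_simp
  have hkR := (abs_kerDiff_le (δ := δ) hcr hcR).trans hk3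
  have hkr := (abs_kerDiff_le (δ := δ) hcr hcr').trans hk3
  have hRr : |‖R‖ - r| ≤ K * t ^ 2 := by
    rw [← hR₀]; exact (abs_norm_sub_norm_le R R₀).trans hRR
  have hkd := (abs_kerDiff_sub_le (δ := δ) hcr hcR hcr').trans
    (mul_le_mul hk4 hRr (abs_nonneg _) (by positivity))
  have hsplit : (kerDiff δ ‖R‖ * ⟪R, w⟫) • R - (kerDiff δ r * ⟪R₀, v⟫) • R₀ =
      (kerDiff δ ‖R‖ * ⟪R, w - v⟫) • R + ((kerDiff δ ‖R‖ - kerDiff δ r) * ⟪R, v⟫) • R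
        + kerDiff δ r • (⟪R - R₀, v⟫ • R + ⟪R₀, v⟫ • (R - R₀)) := by
    rw [inner_sub_right, inner_sub_left]
    module
  have h1 : ‖(kerDiff δ ‖R‖ * ⟪R, w - v⟫) • R‖ ≤
      (3 / c ^ 6 * D / r ^ 3) * ((M * r) * (F * r)) * (M * r) := by
    rw [norm_smul, norm_mul]
    gcongr
    · exact hkR
    · exact (norm_inner_le_norm _ _).trans (by gcongr; exact hwv.trans (by gcongr))
  have h2 : ‖((kerDiff δ ‖R‖ - kerDiff δ r) * ⟪R, v⟫) • R‖ ≤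
      (15 / c ^ 6 * D / r ^ 4 * (K * r ^ 2)) * ((M * r) * F) * (M * r) := by
    rw [norm_smul, norm_mul]
    gcongr
    · exact hkd.trans (by gcongr)
    · exact (norm_inner_le_norm _ _).trans (by gcongr)
  have h3 : ‖kerDiff δ r • (⟪R - R₀, v⟫ • R + ⟪R₀, v⟫ • (R - R₀))‖ ≤
      (3 / c ^ 6 * D / r ^ 3) * (((K * r ^ 2) * F) * (M * r) + (r * F) * (K * r ^ 2)) := by
    have hRR' : ‖R - R₀‖ ≤ K * r ^ 2 := hRR.trans (by gcongr)
    rw [norm_smul]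
    refine mul_le_mul hkr ((norm_add_le _ _).trans (add_le_add ?_ ?_)) (norm_nonneg _)
      (by positivity)
    · rw [norm_smul]
      gcongr
      exact (norm_inner_le_norm _ _).trans (by gcongr)
    · rw [norm_smul]
      gcongr
      exact (norm_inner_le_norm _ _).trans (by rw [hR₀]; gcongr)
  rw [hsplit]
  calc _ ≤ _ := (norm_add_le _ _).trans (add_le_add ((norm_add_le _ _).trans (add_le_add h1 h2)) h3)
    _ = (3 * M ^ 2 + 15 * K * M ^ 2 + 3 * K * (M + 1)) / c ^ 6 * F * D := by field_simp
    _ ≤ _ := by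
      by_cases hδ : δ = 0
      · simp [hD, hδ]
      · rw [hD]; gcongr

theorem hasDerivAt_sqrt_sq_add {b s : ℝ} (h : 0 < s ^ 2 + b) :
    HasDerivAt (fun x : ℝ => √(x ^ 2 + b)) (s / √(s ^ 2 + b)) s := by
  have h1 : HasDerivAt (fun x : ℝ => x ^ 2 + b) (2 * s) s := by
    simpa using (hasDerivAt_pow 2 s).add_const b
  refine (h1.sqrt h.ne').congr_deriv ?_
  field_simp

theorem hasDerivAt_log_sub_div {b s : ℝ} (hb : 0 < b) :
    HasDerivAt (fun x : ℝ => Real.log (x + √(x ^ 2 + b)) - x / √(x ^ 2 + b))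
      (s ^ 2 * (√(s ^ 2 + b) ^ 3)⁻¹) s := by
  have h : 0 < s ^ 2 + b := by positivity
  have hA : 0 < √(s ^ 2 + b) := Real.sqrt_pos.2 h
  have hA2 : √(s ^ 2 + b) ^ 2 = s ^ 2 + b := Real.sq_sqrt h.le
  have hpos : 0 < s + √(s ^ 2 + b) := by
    have : |s| < √(s ^ 2 + b) := Real.lt_sqrt_of_sq_lt (by rw [sq_abs]; linarith)
    linarith [neg_abs_le s]
  have hd := hasDerivAt_sqrt_sq_add h
  refine ((((hasDerivAt_id s).add hd).log hpos.ne').sub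
    ((hasDerivAt_id s).div hd hA.ne')).congr_deriv ?_
  simp only [id, Pi.add_apply]
  field_simp
  ring

theorem hasDerivAt_div_sqrt {b s : ℝ} (hb : 0 < b) :
    HasDerivAt (fun x : ℝ => x / (b * √(x ^ 2 + b))) ((√(s ^ 2 + b) ^ 3)⁻¹) s := by
  have h : 0 < s ^ 2 + b := by positivity
  have hA : 0 < √(s ^ 2 + b) := Real.sqrt_pos.2 h
  have hA2 : √(s ^ 2 + b) ^ 2 = s ^ 2 + b := Real.sq_sqrt h.le
  refine ((hasDerivAt_id s).div ((hasDerivAt_sqrt_sq_add h).const_mul b)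
    (by positivity)).congr_deriv ?_
  simp only [id]
  field_simp
  linarith

theorem hasDerivAt_neg_inv_sqrt {b s : ℝ} (hb : 0 < b) :
    HasDerivAt (fun x : ℝ => -(√(x ^ 2 + b))⁻¹) (s * (√(s ^ 2 + b) ^ 3)⁻¹) s := by
  have h : 0 < s ^ 2 + b := by positivity
  have hA : 0 < √(s ^ 2 + b) := Real.sqrt_pos.2 h
  refine ((hasDerivAt_sqrt_sq_add h).inv hA.ne').neg.congr_deriv ?_
  field_simp

theorem integral_inv_sqrt_pow_three_smul {E : Type*} [NormedAddCommGroup E] [NormedSpace ℝ E]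
    [CompleteSpace E] {b : ℝ} (hb : 0 < b) (x y z : E) :
    ∫ t in (-(1 : ℝ) / 2)..(1 / 2), (√(t ^ 2 + b) ^ 3)⁻¹ • (t ^ 2 • x + t • y + z) =
      (2 * Real.log (1 / 2 + √(1 / 4 + b)) - Real.log b - (√(1 / 4 + b))⁻¹) • x
        + (b * √(1 / 4 + b))⁻¹ • z := by
  have hderiv : ∀ t ∈ Set.uIcc (-(1 : ℝ) / 2) (1 / 2), HasDerivAt
      (fun t : ℝ => (Real.log (t + √(t ^ 2 + b)) - t / √(t ^ 2 + b)) • x +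
        (-(√(t ^ 2 + b))⁻¹) • y + (t / (b * √(t ^ 2 + b))) • z)
      ((√(t ^ 2 + b) ^ 3)⁻¹ • (t ^ 2 • x + t • y + z)) t := by
    intro t _
    refine ((((hasDerivAt_log_sub_div hb).smul_const x).add
      ((hasDerivAt_neg_inv_sqrt hb).smul_const y)).add
      ((hasDerivAt_div_sqrt hb).smul_const z)).congr_deriv ?_
    module
  have hcont : Continuous
      (fun t : ℝ => (√(t ^ 2 + b) ^ 3)⁻¹ • (t ^ 2 • x + t • y + z)) := by
    refine Continuous.smul (Continuous.inv₀ (by fun_prop) fun t => ?_) (by fun_prop)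
    have : 0 < √(t ^ 2 + b) := Real.sqrt_pos.2 (by positivity)
    positivity
  rw [intervalIntegral.integral_eq_sub_of_hasDerivAt hderiv (hcont.intervalIntegrable _ _)]
  have e1 : ((1 : ℝ) / 2) ^ 2 + b = 1 / 4 + b := by ring
  have e2 : (-(1 : ℝ) / 2) ^ 2 + b = 1 / 4 + b := by ring
  rw [e1, e2]
  have hy : 0 < √(1 / 4 + b) := Real.sqrt_pos.2 (by positivity)
  have hy2 : √(1 / 4 + b) ^ 2 = 1 / 4 + b := Real.sq_sqrt (by positivity)
  set Y := √(1 / 4 + b)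
  have hY : -(1 : ℝ) / 2 + Y = b / (1 / 2 + Y) := by
    rw [eq_div_iff (by positivity)]; linarith
  rw [hY, Real.log_div hb.ne' (by positivity)]
  have e3 : (b * Y)⁻¹ = 2 * (1 / 2 / (b * Y)) := by field_simp
  have e4 : Y⁻¹ = 2 * (1 / 2 / Y) := by field_simp
  have e5 : -(1 : ℝ) / 2 / Y = - (1 / 2 / Y) := by ring
  have e6 : -(1 : ℝ) / 2 / (b * Y) = - (1 / 2 / (b * Y)) := by ring
  rw [e3, e4, e5, e6]
  module

theorem integral_sq_div_sq_add_sq_le {δ : ℝ} (hδ : 0 < δ) :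
    ∫ t in (-(1 : ℝ) / 2)..(1 / 2), δ ^ 2 / (t ^ 2 + δ ^ 2) ≤ 4 * δ := by
  have h : ∀ t : ℝ, δ ^ 2 / (t ^ 2 + δ ^ 2) = δ ^ 2 * (δ ^ 2 + t ^ 2)⁻¹ := fun t => by
    rw [div_eq_mul_inv, add_comm]
  simp_rw [h]
  rw [intervalIntegral.integral_const_mul, integral_inv_sq_add_sq hδ.ne', ← mul_assoc,
    show δ ^ 2 * δ⁻¹ = δ by field_simp, mul_comm 4]
  have h1 := Real.arctan_lt_pi_div_two (1 / 2 / δ)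
  have h2 := Real.neg_pi_div_two_lt_arctan (-(1 : ℝ) / 2 / δ)
  gcongr
  linarith [Real.pi_lt_four]

theorem sqrt_quarter_add_sub_le {p q : ℝ} (hp : 0 ≤ p) (hq : 0 ≤ q) :
    √(1 / 4 + (p + q)) - √(1 / 4 + p) ≤ q ∧ √(1 / 4 + p) ≤ √(1 / 4 + (p + q)) ∧
      1 / 2 ≤ √(1 / 4 + p) := by
  have h1 : 1 / 2 ≤ √(1 / 4 + p) := Real.le_sqrt_of_sq_le (by linarith)
  have h2 : √(1 / 4 + p) ≤ √(1 / 4 + (p + q)) := Real.sqrt_le_sqrt (by linarith)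
  have e1 : √(1 / 4 + p) ^ 2 = 1 / 4 + p := Real.sq_sqrt (by linarith)
  have e2 : √(1 / 4 + (p + q)) ^ 2 = 1 / 4 + (p + q) := Real.sq_sqrt (by linarith)
  exact ⟨by nlinarith, h2, h1⟩

theorem abs_tangential_coefficient_le {p q : ℝ} (hp : 0 < p) (hq : 0 < q) :
    |(2 * Real.log (1 / 2 + √(1 / 4 + (p + q))) - Real.log (p + q) - (√(1 / 4 + (p + q)))⁻¹)
      - (2 * Real.log (1 / 2 + √(1 / 4 + p)) - Real.log p - (√(1 / 4 + p))⁻¹)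
      + Real.log (1 + q / p)| ≤ 6 * q := by
  obtain ⟨h1, h2, h3⟩ := sqrt_quarter_add_sub_le hp.le hq.le
  set y := √(1 / 4 + p)
  set x := √(1 / 4 + (p + q))
  have hy : 0 < y := by linarith
  have hx : 0 < x := by linarith
  have hlog : Real.log (1 + q / p) = Real.log (p + q) - Real.log p := by
    rw [← Real.log_div (by positivity) hp.ne']
    congr 1
    field_simp
  have l1 : 0 ≤ Real.log (1 / 2 + x) - Real.log (1 / 2 + y) :=
    sub_nonneg.2 (Real.log_le_log (by positivity) (by linarith))
  have l2 : Real.log (1 / 2 + x) - Real.log (1 / 2 + y) ≤ q := by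
    rw [← Real.log_div (by positivity) (by positivity)]
    refine (Real.log_le_sub_one_of_pos (by positivity)).trans ?_
    rw [div_sub_one (by positivity), div_le_iff₀ (by positivity)]
    nlinarith
  have i1 : 0 ≤ y⁻¹ - x⁻¹ := sub_nonneg.2 (inv_anti₀ hy h2)
  have i2 : y⁻¹ - x⁻¹ ≤ 4 * q := by
    rw [inv_sub_inv hy.ne' hx.ne', div_le_iff₀ (by positivity)]
    have : 1 / 4 ≤ y * x := by nlinarith
    nlinarith
  rw [hlog, abs_le]
  constructor <;> linarith

theorem abs_normal_coefficient_le {p q : ℝ} (hp : 0 < p) (hq : 0 < q) :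
    |(((p + q) * √(1 / 4 + (p + q)))⁻¹ - (p * √(1 / 4 + p))⁻¹) * p + 2 * q / (p + q)| ≤
      8 * (p + q) := by
  have bound : ∀ u : ℝ, 0 ≤ u → 0 ≤ 2 - (√(1 / 4 + u))⁻¹ ∧ 2 - (√(1 / 4 + u))⁻¹ ≤ 4 * u := by
    intro u hu
    have h0 : √(1 / 4 : ℝ) = 1 / 2 := by
      rw [show (1 / 4 : ℝ) = (1 / 2) ^ 2 by norm_num]; exact Real.sqrt_sq (by norm_num)
    obtain ⟨h1, h2, -⟩ := sqrt_quarter_add_sub_le le_rfl hu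
    simp only [zero_add, add_zero, h0] at h1 h2
    have hx : 0 < √(1 / 4 + u) := by linarith
    have : 2 - (√(1 / 4 + u))⁻¹ = (2 * √(1 / 4 + u) - 1) / √(1 / 4 + u) := by field_simp
    rw [this]
    refine ⟨div_nonneg (by linarith) hx.le, ?_⟩
    rw [div_le_iff₀ hx]
    nlinarith
  obtain ⟨a1, a2⟩ := bound (p + q) (by positivity)
  obtain ⟨b1, b2⟩ := bound p hp.le
  have hx : √(1 / 4 + (p + q)) ≠ 0 := (Real.sqrt_pos.2 (by positivity)).ne'
  have hy : √(1 / 4 + p) ≠ 0 := (Real.sqrt_pos.2 (by positivity)).ne'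
  have key : (((p + q) * √(1 / 4 + (p + q)))⁻¹ - (p * √(1 / 4 + p))⁻¹) * p + 2 * q / (p + q) =
      (2 - (√(1 / 4 + p))⁻¹) - p / (p + q) * (2 - (√(1 / 4 + (p + q)))⁻¹) := by
    field_simp
    ring
  have hfrac : p / (p + q) ≤ 1 := by rw [div_le_one (by positivity)]; linarith
  have hfrac0 : 0 ≤ p / (p + q) := by positivity
  have m1 := mul_nonneg hfrac0 a1
  have m2 := mul_le_of_le_one_left a1 hfrac
  rw [key, abs_le]
  constructor <;> linarith

theorem norm_integral_straight_line_add_le {E : Type*} [NormedAddCommGroup E]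
    [InnerProductSpace ℝ E] [CompleteSpace E] {e n v : E} {ε δ F : ℝ} (he : ‖e‖ = 1)
    (hn : ‖n‖ = 1) (hε : 0 < ε) (hδ : 0 < δ) (hv : ‖v‖ ≤ F) :
    ‖(∫ t in (-(1 : ℝ) / 2)..(1 / 2),
          (kerDiff δ √(t ^ 2 + ε ^ 2) * ⟪t • e + ε • n, v⟫) • (t • e + ε • n))
        + Real.log (1 + δ ^ 2 / ε ^ 2) • ⟪e, v⟫ • e
        + (2 * δ ^ 2 / (ε ^ 2 + δ ^ 2)) • ⟪n, v⟫ • n‖ ≤ 14 * (ε ^ 2 + δ ^ 2) * F := by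
  have hp : 0 < ε ^ 2 := by positivity
  have hq : 0 < δ ^ 2 := by positivity
  have hF : 0 ≤ F := (norm_nonneg v).trans hv
  set x := ⟪e, v⟫ • e
  set y := (ε * ⟪e, v⟫) • n + (ε * ⟪n, v⟫) • e
  set z := ⟪n, v⟫ • n
  have hint : ∀ t : ℝ,
      (kerDiff δ √(t ^ 2 + ε ^ 2) * ⟪t • e + ε • n, v⟫) • (t • e + ε • n) =
        (√(t ^ 2 + (ε ^ 2 + δ ^ 2)) ^ 3)⁻¹ • (t ^ 2 • x + t • y + ε ^ 2 • z) -
          (√(t ^ 2 + ε ^ 2) ^ 3)⁻¹ • (t ^ 2 • x + t • y + ε ^ 2 • z) := by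
    intro t
    rw [kerDiff, Real.sq_sqrt (by positivity), add_assoc, inner_add_left, real_inner_smul_left,
      real_inner_smul_left]
    module
  have hii : ∀ b : ℝ, 0 < b → IntervalIntegrable
      (fun t : ℝ => (√(t ^ 2 + b) ^ 3)⁻¹ • (t ^ 2 • x + t • y + ε ^ 2 • z)) volume
        (-(1 : ℝ) / 2) (1 / 2) := by
    intro b hb
    refine (Continuous.smul (Continuous.inv₀ (by fun_prop) fun t => ?_)
      (by fun_prop)).intervalIntegrable _ _
    have : 0 < √(t ^ 2 + b) := Real.sqrt_pos.2 (by positivity)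
    positivity
  simp_rw [hint]
  rw [intervalIntegral.integral_sub (hii _ (by positivity)) (hii _ hp),
    integral_inv_sqrt_pow_three_smul (by positivity), integral_inv_sqrt_pow_three_smul hp]
  have hx : ‖x‖ ≤ F := by
    rw [norm_smul, he, mul_one]
    exact (norm_inner_le_norm _ _).trans (by rw [he, one_mul]; exact hv)
  have hz : ‖z‖ ≤ F := by
    rw [norm_smul, hn, mul_one]
    exact (norm_inner_le_norm _ _).trans (by rw [hn, one_mul]; exact hv)
  have h1 := abs_tangential_coefficient_le hp hq
  have h2 := abs_normal_coefficient_le hp hq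
  have hcomb : ∀ α β : ℝ, |α| ≤ 6 * δ ^ 2 → |β| ≤ 8 * (ε ^ 2 + δ ^ 2) → ∀ G : E,
      G = α • x + β • z → ‖G‖ ≤ 14 * (ε ^ 2 + δ ^ 2) * F := by
    rintro α β hα hβ G rfl
    refine (norm_add_le _ _).trans ?_
    rw [norm_smul α x, norm_smul β z, Real.norm_eq_abs, Real.norm_eq_abs]
    calc _ ≤ 6 * δ ^ 2 * F + 8 * (ε ^ 2 + δ ^ 2) * F := by gcongr
      _ ≤ _ := by nlinarith [mul_nonneg hp.le hF]
  exact hcomb _ _ h1 h2 _ (by module)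

theorem norm_le_C0norm {f : ℝ → V3} (hf : Continuous f) (hper : ∀ s, f (s + 1) = f s) (s : ℝ) :
    ‖f s‖ ≤ C0norm f := by
  have hb := Function.Periodic.isBounded_of_continuous (f := f) (c := 1) hper one_ne_zero hf
  obtain ⟨B, hB⟩ := hb.exists_norm_le
  exact le_ciSup (f := fun s => ‖f s‖) ⟨B, by rintro _ ⟨t, rfl⟩; exact hB _ ⟨t, rfl⟩⟩ s

theorem deriv_periodic {f : ℝ → V3} (hper : ∀ s, f (s + 1) = f s) (s : ℝ) :
    deriv f (s + 1) = deriv f s := by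
  rw [← deriv_comp_add_const, funext hper]

theorem C0norm_nonneg (f : ℝ → V3) : 0 ≤ C0norm f := Real.iSup_nonneg fun _ => norm_nonneg _

theorem norm_le_C1norm {f : ℝ → V3} (hf : Continuous f) (hper : ∀ s, f (s + 1) = f s) (s : ℝ) :
    ‖f s‖ ≤ C1norm f :=
  (norm_le_C0norm hf hper s).trans (le_add_of_nonneg_right (C0norm_nonneg _))

theorem norm_sub_le_C1norm_mul {f : ℝ → V3} (hf : ContDiff ℝ 1 f) (hper : ∀ s, f (s + 1) = f s)
    (s t : ℝ) : ‖f (s - t) - f s‖ ≤ C1norm f * |t| := by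
  have h := Convex.norm_image_sub_le_of_norm_deriv_le (𝕜 := ℝ) (s := Set.univ) (f := f)
    (C := C1norm f) (x := s) (y := s - t)
    (fun x _ => hf.differentiable (by norm_num) x)
    (fun x _ => (norm_le_C0norm (hf.continuous_deriv le_rfl) (deriv_periodic hper) x).trans
      (le_add_of_nonneg_left (C0norm_nonneg _))) convex_univ trivial trivial
  simpa using h

theorem norm_sub_sub_smul_deriv_le {E : Type*} [NormedAddCommGroup E] [NormedSpace ℝ E]
    {X : ℝ → E} {K : ℝ} (hX : ContDiff ℝ 2 X) (hK : ∀ s, ‖deriv (deriv X) s‖ ≤ K) (s t : ℝ) :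
    ‖X s - X (s - t) - t • deriv X s‖ ≤ K * t ^ 2 := by
  have hX' : Differentiable ℝ (deriv X) :=
    (contDiff_succ_iff_deriv.1 (show ContDiff ℝ (1 + 1) X by exact_mod_cast hX)).2.2.differentiable
      (by norm_num)
  have hXd : Differentiable ℝ X := hX.differentiable (by norm_num)
  have hd : ∀ τ : ℝ, HasDerivAt (fun τ => X s - X (s - τ) - τ • deriv X s)
      (deriv X (s - τ) - deriv X s) τ := by
    intro τ
    have h1 : HasDerivAt (fun τ : ℝ => s - τ) (-1) τ := by
      simpa using (hasDerivAt_id τ).const_sub s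
    have h2 := ((hXd (s - τ)).hasDerivAt).scomp τ h1
    refine ((h2.const_sub (X s)).sub ((hasDerivAt_id τ).smul_const (deriv X s))).congr_deriv ?_
    simp
  have hlip : ∀ τ ∈ Set.uIcc 0 t, ‖deriv X (s - τ) - deriv X s‖ ≤ K * |t| := by
    intro τ hτ
    have h := Convex.norm_image_sub_le_of_norm_deriv_le (𝕜 := ℝ) (s := Set.univ) (f := deriv X)
      (x := s) (y := s - τ) (fun x _ => hX' x) (fun x _ => hK x) convex_univ trivial trivial
    have hK0 : 0 ≤ K := (norm_nonneg _).trans (hK s)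
    refine h.trans (mul_le_mul_of_nonneg_left ?_ hK0)
    have := Set.abs_sub_left_of_mem_uIcc hτ
    simpa using this
  have h := Convex.norm_image_sub_le_of_norm_hasDerivWithin_le (𝕜 := ℝ) (s := Set.uIcc 0 t)
    (fun τ _ => (hd τ).hasDerivWithinAt) hlip (convex_uIcc 0 t) Set.left_mem_uIcc
    Set.right_mem_uIcc
  calc _ ≤ K * |t| * |t| := by simpa using h
    _ = _ := by rw [mul_assoc, abs_mul_abs_self, sq]

theorem continuousOn_kerDiff (δ : ℝ) : ContinuousOn (kerDiff δ) (Set.Ioi 0) :=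
  fun _ hx => (hasDerivAt_kerDiff hx).continuousAt.continuousWithinAt

theorem min_mul_sqrt_le_norm {E : Type*} [NormedAddCommGroup E] {R R₀ : E} {a K t ε : ℝ}
    (ha : 0 < a) (hK : 0 < K) (hε : 0 < ε) (hεa : ε ≤ a / (4 * K)) (hεK : ε ≤ 1 / (2 * K))
    (hR₀ : ‖R₀‖ = √(t ^ 2 + ε ^ 2)) (hRR : ‖R - R₀‖ ≤ K * t ^ 2) (hR : a * |t| ≤ ‖R‖ + ε) :
    min (1 / 2) (a / 4) * √(t ^ 2 + ε ^ 2) ≤ ‖R‖ := by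
  rcases le_or_gt |t| (1 / (2 * K)) with ht | ht
  · have h1 : K * t ^ 2 ≤ |t| / 2 := by
      rw [le_div_iff₀ (by positivity)] at ht
      rw [← sq_abs]
      nlinarith [abs_nonneg t]
    have h2 : |t| ≤ √(t ^ 2 + ε ^ 2) := Real.abs_le_sqrt (by nlinarith)
    have h3 : ‖R₀‖ - ‖R‖ ≤ ‖R - R₀‖ := by
      rw [norm_sub_rev]; exact norm_sub_norm_le _ _
    calc _ ≤ 1 / 2 * √(t ^ 2 + ε ^ 2) := by gcongr; exact min_le_left _ _
      _ ≤ _ := by linarith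
  · have h1 : 2 * ε ≤ a * |t| :=
      calc 2 * ε ≤ 2 * (a / (4 * K)) := by gcongr
        _ = a * (1 / (2 * K)) := by field_simp; norm_num
        _ ≤ _ := by gcongr
    have h2 : √(t ^ 2 + ε ^ 2) ≤ 2 * |t| := by
      refine Real.sqrt_le_iff.2 ⟨by positivity, ?_⟩
      have : ε ^ 2 ≤ |t| ^ 2 := by gcongr; linarith
      rw [mul_pow, ← sq_abs t]
      nlinarith [sq_nonneg |t|]
    calc _ ≤ a / 4 * (2 * |t|) := by gcongr; exact min_le_right _ _
      _ ≤ _ := by linarith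

namespace SlenderGeom

variable {cΓ κmax : ℝ} {X en1 en2 : ℝ → V3}

theorem inner_deriv_ePerp (hX : SlenderGeom cΓ κmax X en1 en2) (s θ : ℝ) :
    ⟪deriv X s, ePerp en1 en2 s θ⟫ = 0 := by
  simp [ePerp, inner_add_right, real_inner_smul_right, hX.es_en1, hX.es_en2]

theorem norm_ePerp (hX : SlenderGeom cΓ κmax X en1 en2) (s θ : ℝ) :
    ‖ePerp en1 en2 s θ‖ = 1 := by
  have h : ‖ePerp en1 en2 s θ‖ ^ 2 = 1 := by
    rw [ePerp, norm_add_sq_real, norm_smul, norm_smul, real_inner_smul_left,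
      real_inner_smul_right, hX.en1_en2, hX.en1_unit, hX.en2_unit]
    simp
  exact (pow_eq_one_iff_of_nonneg (norm_nonneg _) two_ne_zero).1 h

theorem norm_smul_deriv_add (hX : SlenderGeom cΓ κmax X en1 en2) (ε s θ t : ℝ) :
    ‖t • deriv X s + ε • ePerp en1 en2 s θ‖ = √(t ^ 2 + ε ^ 2) := by
  rw [← Real.sqrt_sq (norm_nonneg _), norm_add_sq_real, norm_smul, norm_smul,
    real_inner_smul_left, real_inner_smul_right, hX.inner_deriv_ePerp, hX.norm_ePerp,
    hX.arclength]
  simp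

theorem norm_Rvec_sub_le (hX : SlenderGeom cΓ κmax X en1 en2) (ε s θ t : ℝ) :
    ‖Rvec X en1 en2 ε s t θ - (t • deriv X s + ε • ePerp en1 en2 s θ)‖ ≤ κmax * t ^ 2 := by
  refine le_of_eq_of_le ?_ (norm_sub_sub_smul_deriv_le hX.smooth hX.curvature_max s t)
  rw [Rvec]
  congr 1
  module

theorem mul_abs_le_norm_Rvec_add (hX : SlenderGeom cΓ κmax X en1 en2) {ε t : ℝ} (hε : 0 < ε)
    (ht : |t| ≤ 1 / 2) (s θ : ℝ) : cΓ * |t| ≤ ‖Rvec X en1 en2 ε s t θ‖ + ε := by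
  have h := hX.no_self_intersect s (s - t) (by simpa using ht)
  rw [sub_sub_cancel] at h
  have h2 : X s - X (s - t) = Rvec X en1 en2 ε s t θ - ε • ePerp en1 en2 s θ := by
    rw [Rvec]; module
  rw [h2] at h
  refine h.trans ((norm_sub_le _ _).trans_eq ?_)
  rw [norm_smul, hX.norm_ePerp, mul_one, Real.norm_of_nonneg hε.le]

theorem continuous_Rvec (hX : SlenderGeom cΓ κmax X en1 en2) (ε s θ : ℝ) :
    Continuous fun t => Rvec X en1 en2 ε s t θ :=
  continuous_const.sub (hX.smooth.continuous.comp (continuous_const.sub continuous_id))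

/-- The integral over the curved fiber differs from its straight-line model by `O(δ)`. -/
theorem norm_integral_add_le (hX : SlenderGeom cΓ κmax X en1 en2) {K ε δ : ℝ} (hcΓ : 0 < cΓ)
    (hK : 0 < K) (hκ : κmax ≤ K) (hε : 0 < ε) (hεc : ε ≤ cΓ / (4 * K)) (hεK : ε ≤ 1 / (2 * K))
    (hδ : 0 < δ) {f : ℝ → V3} (hf : ContDiff ℝ 1 f) (hper : ∀ s, f (s + 1) = f s) (s θ : ℝ) :
    ‖(∫ t in (-(1 : ℝ) / 2)..(1 / 2),
          (kerDiff δ ‖Rvec X en1 en2 ε s t θ‖ * ⟪Rvec X en1 en2 ε s t θ, f (s - t)⟫) •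
            Rvec X en1 en2 ε s t θ)
        + Real.log (1 + δ ^ 2 / ε ^ 2) • ⟪deriv X s, f s⟫ • deriv X s
        + (2 * δ ^ 2 / (ε ^ 2 + δ ^ 2)) • ⟪ePerp en1 en2 s θ, f s⟫ • ePerp en1 en2 s θ‖ ≤
      (3 * (1 + K) ^ 2 + 15 * K * (1 + K) ^ 2 + 3 * K * (1 + K + 1)) / min (1 / 2) (cΓ / 4) ^ 6 *
          C1norm f * (4 * δ) + 14 * (ε ^ 2 + δ ^ 2) * C1norm f := by
  set e := deriv X s
  set n := ePerp en1 en2 s θ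
  set R : ℝ → V3 := fun t => Rvec X en1 en2 ε s t θ
  set c := min (1 / 2) (cΓ / 4)
  set B := (3 * (1 + K) ^ 2 + 15 * K * (1 + K) ^ 2 + 3 * K * (1 + K + 1)) / c ^ 6
  have hc : 0 < c := by positivity
  have hc1 : c ≤ 1 := (min_le_left _ _).trans (by norm_num)
  have hr : ∀ t : ℝ, 0 < √(t ^ 2 + ε ^ 2) := fun t => Real.sqrt_pos.2 (by positivity)
  have hR₀ : ∀ t : ℝ, ‖t • e + ε • n‖ = √(t ^ 2 + ε ^ 2) := hX.norm_smul_deriv_add ε s θ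
  have hRR : ∀ t, ‖R t - (t • e + ε • n)‖ ≤ K * t ^ 2 := fun t =>
    (hX.norm_Rvec_sub_le ε s θ t).trans (by gcongr)
  have habs : ∀ t ∈ Set.Icc (-(1 : ℝ) / 2) (1 / 2), |t| ≤ 1 / 2 := fun t ht =>
    abs_le.2 ⟨by linarith [ht.1], ht.2⟩
  have hlow : ∀ t ∈ Set.Icc (-(1 : ℝ) / 2) (1 / 2), c * √(t ^ 2 + ε ^ 2) ≤ ‖R t‖ := fun t ht =>
    min_mul_sqrt_le_norm hcΓ hK hε hεc hεK (hR₀ t) (hRR t)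
      (hX.mul_abs_le_norm_Rvec_add hε (habs t ht) s θ)
  have hcontR : Continuous R := hX.continuous_Rvec ε s θ
  have hfc : Continuous fun t => f (s - t) :=
    hf.continuous.comp (continuous_const.sub continuous_id)
  have hle : -(1 : ℝ) / 2 ≤ 1 / 2 := by norm_num
  have hG : IntervalIntegrable (fun t => (kerDiff δ ‖R t‖ * ⟪R t, f (s - t)⟫) • R t) volume
      (-(1 : ℝ) / 2) (1 / 2) := by
    refine ContinuousOn.intervalIntegrable ?_
    rw [Set.uIcc_of_le hle]
    refine ContinuousOn.smul (ContinuousOn.mul ((continuousOn_kerDiff δ).comp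
      hcontR.norm.continuousOn fun t ht => ?_) (hcontR.inner hfc).continuousOn)
      hcontR.continuousOn
    exact (mul_pos hc (hr t)).trans_le (hlow t ht)
  have hG₀ : IntervalIntegrable (fun t : ℝ =>
      (kerDiff δ √(t ^ 2 + ε ^ 2) * ⟪t • e + ε • n, f s⟫) • (t • e + ε • n)) volume
      (-(1 : ℝ) / 2) (1 / 2) := by
    refine ContinuousOn.intervalIntegrable ?_
    exact ContinuousOn.smul (ContinuousOn.mul ((continuousOn_kerDiff δ).comp
      (by fun_prop) fun t _ => hr t) (by fun_prop)) (by fun_prop)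
  have hbound : ∀ t ∈ Set.Icc (-(1 : ℝ) / 2) (1 / 2),
      ‖(kerDiff δ ‖R t‖ * ⟪R t, f (s - t)⟫) • R t -
        (kerDiff δ √(t ^ 2 + ε ^ 2) * ⟪t • e + ε • n, f s⟫) • (t • e + ε • n)‖ ≤
      B * C1norm f * (δ ^ 2 / (t ^ 2 + δ ^ 2)) := by
    intro t ht
    have htr : |t| ≤ √(t ^ 2 + ε ^ 2) := Real.abs_le_sqrt (by nlinarith)
    refine norm_kerDiff_smul_sub_le hc hc1 hK.le (hr t) htr (hR₀ t) (hlow t ht) ?_ (hRR t)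
      (norm_le_C1norm hf.continuous hper s) (norm_sub_le_C1norm_mul hf hper s t)
    have h1 : K * t ^ 2 ≤ K * √(t ^ 2 + ε ^ 2) := by
      have := habs t ht
      gcongr
      exact le_trans (by nlinarith [sq_abs t, abs_nonneg t]) htr
    linarith [norm_le_norm_add_norm_sub' (R t) (t • e + ε • n), hRR t, hR₀ t]
  have hdiff : ‖∫ t in (-(1 : ℝ) / 2)..(1 / 2), ((kerDiff δ ‖R t‖ * ⟪R t, f (s - t)⟫) • R t -
        (kerDiff δ √(t ^ 2 + ε ^ 2) * ⟪t • e + ε • n, f s⟫) • (t • e + ε • n))‖ ≤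
      B * C1norm f * (4 * δ) := by
    have hF : 0 ≤ C1norm f := add_nonneg (C0norm_nonneg _) (C0norm_nonneg _)
    have hint : IntervalIntegrable (fun t : ℝ => B * C1norm f * (δ ^ 2 / (t ^ 2 + δ ^ 2))) volume
        (-(1 : ℝ) / 2) (1 / 2) :=
      (continuous_const.mul (continuous_const.div (by fun_prop)
        fun t => by positivity)).intervalIntegrable _ _
    refine (intervalIntegral.norm_integral_le_of_norm_le hle
      (Filter.Eventually.of_forall fun t ht => hbound t (Set.Ioc_subset_Icc_self ht)) hint).trans ?_
    rw [intervalIntegral.integral_const_mul]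
    gcongr
    exact integral_sq_div_sq_add_sq_le hδ
  have hmodel := norm_integral_straight_line_add_le (hX.arclength s) (hX.norm_ePerp s θ) hε hδ
    (norm_le_C1norm hf.continuous hper s)
  rw [intervalIntegral.integral_sub hG hG₀] at hdiff
  refine le_trans (le_of_eq_of_le ?_ (norm_add_le _ _)) (add_le_add hdiff hmodel)
  congr 1
  abel

end SlenderGeom

theorem half_le_abs_log {x : ℝ} (hx : 0 < x) (hx2 : x ≤ 1 / 2) : 1 / 2 ≤ |Real.log x| := by
  rw [abs_of_nonpos (Real.log_nonpos hx.le (by linarith))]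
  linarith [Real.log_le_sub_one_of_pos hx]

/-- Second Stokeslet difference term at the fiber surface:
`|S₂ + log(1+δ²/ε²) e_s(e_s·f) + (2δ²/(ε²+δ²)) e_ρ(e_ρ·f)|
  ≤ C √(ε²+δ²) |log(ε²+δ²)| ‖f‖_{C¹}`. -/
theorem surface_stokeslet_term_S2 (cΓ κmax : ℝ) (hcΓ : 0 < cΓ) :
    ∃ C > 0, ∃ ε₀ > 0,
      ∀ X en1 en2 : ℝ → V3, SlenderGeom cΓ κmax X en1 en2 →
      ∀ ε δ : ℝ, 0 < ε → ε < ε₀ → 0 < δ → δ < ε₀ →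
      ∀ f : ℝ → V3, ContDiff ℝ 1 f → (∀ s, f (s + 1) = f s) →
      ∀ s θ : ℝ,
        ‖(∫ sb in (-(1:ℝ)/2)..(1/2),
              ((((‖Rvec X en1 en2 ε s sb θ‖ ^ 2 + δ ^ 2) ^ ((3 : ℝ) / 2))⁻¹
                    - (‖Rvec X en1 en2 ε s sb θ‖ ^ 3)⁻¹)
                  * ⟪Rvec X en1 en2 ε s sb θ, f (s - sb)⟫) • Rvec X en1 en2 ε s sb θ)
            + Real.log (1 + δ ^ 2 / ε ^ 2) • ⟪deriv X s, f s⟫ • deriv X s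
            + (2 * δ ^ 2 / (ε ^ 2 + δ ^ 2))
                • ⟪ePerp en1 en2 s θ, f s⟫ • ePerp en1 en2 s θ‖
          ≤ C * (ε ^ 2 + δ ^ 2) ^ ((1 : ℝ) / 2) * |Real.log (ε ^ 2 + δ ^ 2)|
              * C1norm f := by
  set K := max κmax 1
  have hK : 0 < K := lt_max_of_lt_right one_pos
  set B := (3 * (1 + K) ^ 2 + 15 * K * (1 + K) ^ 2 + 3 * K * (1 + K + 1)) /
    min (1 / 2) (cΓ / 4) ^ 6
  have hB : 0 < B := by positivity
  refine ⟨2 * (4 * B + 14), by positivity, min (1 / 2) (min (cΓ / (4 * K)) (1 / (2 * K))),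
    by positivity, ?_⟩
  intro X en1 en2 hX ε δ hε hε₀ hδ hδ₀ f hf hper s θ
  obtain ⟨hε1, hε2, hε3⟩ : ε < 1 / 2 ∧ ε < cΓ / (4 * K) ∧ ε < 1 / (2 * K) := by
    simpa only [lt_min_iff] using hε₀
  have hδ1 : δ < 1 / 2 := hδ₀.trans_le (min_le_left _ _)
  have hF : 0 ≤ C1norm f := add_nonneg (C0norm_nonneg _) (C0norm_nonneg _)
  have hmain := hX.norm_integral_add_le hcΓ hK (le_max_left _ _) hε hε2.le hε3.le hδ hf hper s θ
  have hker : ∀ ρ : ℝ, ((ρ ^ 2 + δ ^ 2) ^ ((3 : ℝ) / 2))⁻¹ - (ρ ^ 3)⁻¹ = kerDiff δ ρ := fun ρ => by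
    rw [kerDiff, rpow_three_halves (by positivity)]
  simp_rw [hker]
  refine hmain.trans ?_
  rw [← Real.sqrt_eq_rpow]
  have hlog : 1 / 2 ≤ |Real.log (ε ^ 2 + δ ^ 2)| :=
    half_le_abs_log (by positivity) (by nlinarith)
  have hδA : δ ≤ √(ε ^ 2 + δ ^ 2) := Real.le_sqrt_of_sq_le (by nlinarith)
  have hA2 : √(ε ^ 2 + δ ^ 2) ^ 2 = ε ^ 2 + δ ^ 2 := Real.sq_sqrt (by positivity)
  have hA1 : √(ε ^ 2 + δ ^ 2) ≤ 1 := Real.sqrt_le_one.2 (by nlinarith)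
  have hA0 : 0 ≤ √(ε ^ 2 + δ ^ 2) := Real.sqrt_nonneg _
  calc B * C1norm f * (4 * δ) + 14 * (ε ^ 2 + δ ^ 2) * C1norm f
      ≤ B * C1norm f * (4 * √(ε ^ 2 + δ ^ 2)) + 14 * √(ε ^ 2 + δ ^ 2) * C1norm f := by
        gcongr
        nlinarith
    _ = 2 * (4 * B + 14) * √(ε ^ 2 + δ ^ 2) * (1 / 2) * C1norm f := by ring
    _ ≤ _ := by gcongr
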